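/- arXiv:2203.06389 — 3 statements merged into one kernel-verified Lean document; each statement's English description precedes it below -/
import Mathlib

section
/- Suppose nonnegative vectors q^(0), …, q^(N), r^(0), …, r^(N) ∈ ℝ^V satisfy the GFPush invariant for s, and suppose the GFPush termination condition holds: r^(m)_v ≤ d_v · r_max for every node v and every 0 ≤ m ≤ N−1, where r_max > 0. Then for any weights w_0, …, w_N ≥ 0 with Σ_{n=0}^{N} w_n = 1, the GFPush output satisfies the L1 error bound ‖Π_s − Π̃_s‖₁ ≤ N · (2|E| + |V|) · r_max. (Error-bound part of Theorem 1.) -/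
open Finset Matrix

/-- The row-normalized adjacency matrix `P = D̃⁻¹ Ã` of the self-loop-augmented graph `G̃`:
`P v u = 1 / d_v` if `u` is in the closed neighborhood of `v`, and `0` otherwise,
where `d_v = deg_G v + 1`. -/
noncomputable def rowNormAdj (V : Type) [Fintype V] [DecidableEq V]
    (G : SimpleGraph V) [DecidableRel G.Adj] : Matrix V V ℝ :=
  Matrix.of fun v u => if u = v ∨ G.Adj v u then 1 / ((G.degree v : ℝ) + 1) else 0

theorem rowNormAdj_mem_rowStochastic {V : Type} [Fintype V] [DecidableEq V]
    (G : SimpleGraph V) [DecidableRel G.Adj] :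
    rowNormAdj V G ∈ rowStochastic ℝ V := by
  rw [mem_rowStochastic_iff_sum]
  refine ⟨fun v u => ?_, fun v => ?_⟩
  · simp only [rowNormAdj, Matrix.of_apply]
    split_ifs <;> positivity
  · have hcard : #{u | u = v ∨ G.Adj v u} = G.degree v + 1 := by
      have hins : ({u | u = v ∨ G.Adj v u} : Finset V) = insert v (G.neighborFinset v) := by
        ext u
        simp
      rw [hins, Finset.card_insert_of_notMem (by simp), G.card_neighborFinset_eq_degree]
    simp only [rowNormAdj, Matrix.of_apply]
    rw [← Finset.sum_filter, Finset.sum_const, hcard, nsmul_eq_mul]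
    push_cast
    field_simp

theorem sum_transpose_mulVec_of_mem_rowStochastic {ι : Type*} [Fintype ι] [DecidableEq ι]
    {M : Matrix ι ι ℝ} (hM : M ∈ rowStochastic ℝ ι) (x : ι → ℝ) :
    ∑ u, (Mᵀ.mulVec x) u = ∑ v, x v := by
  simp only [Matrix.mulVec, dotProduct, Matrix.transpose_apply]
  rw [Finset.sum_comm]
  refine Finset.sum_congr rfl fun v _ => ?_
  rw [← Finset.sum_mul, sum_row_of_mem_rowStochastic hM, one_mul]

theorem sum_degree_add_one {V : Type*} [Fintype V] [DecidableEq V]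
    (G : SimpleGraph V) [DecidableRel G.Adj] :
    ∑ v, ((G.degree v : ℝ) + 1) = 2 * (G.edgeFinset.card : ℝ) + (Fintype.card V : ℝ) := by
  rw [Finset.sum_add_distrib]
  congr 1
  · exact_mod_cast G.sum_degrees_eq_twice_card_edges
  · simp

/-- Error-bound part of Theorem 1 of "GRAND+: Scalable Graph Random Neural Networks":
if nonnegative vectors `q⁽⁰⁾, …, q⁽ᴺ⁾, r⁽⁰⁾, …, r⁽ᴺ⁾` satisfy the GFPush invariant for `s`
and the termination condition `r⁽ᵐ⁾_v ≤ d_v · r_max` for all `v` and all `0 ≤ m ≤ N-1`,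
then for any weights `w₀, …, w_N ≥ 0` summing to `1`,
`‖Π_s − Π̃_s‖₁ ≤ N · (2|E| + |V|) · r_max`. -/
theorem gfpush_error_bound
    {V : Type} [Fintype V] [DecidableEq V]
    (G : SimpleGraph V) [DecidableRel G.Adj]
    (s : V) (N : ℕ) (hN : 1 ≤ N)
    (q r : ℕ → V → ℝ)
    (hq : ∀ n ≤ N, ∀ u, 0 ≤ q n u)
    (hr : ∀ n ≤ N, ∀ u, 0 ≤ r n u)
    (hinv : ∀ n ≤ N, ∀ u, (rowNormAdj V G ^ n) s u
      = q n u + ∑ i ∈ Finset.Icc 1 n, ((rowNormAdj V G ^ i)ᵀ.mulVec (r (n - i))) u)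
    (r_max : ℝ) (hrmax : 0 < r_max)
    (hterm : ∀ v : V, ∀ m < N, r m v ≤ ((G.degree v : ℝ) + 1) * r_max)
    (w : ℕ → ℝ) (hw : ∀ n ≤ N, 0 ≤ w n)
    (hwsum : ∑ n ∈ Finset.range (N + 1), w n = 1) :
    ∑ u, |(∑ n ∈ Finset.range (N + 1), w n * (rowNormAdj V G ^ n) s u)
        - ∑ n ∈ Finset.range (N + 1), w n * q n u|
      ≤ (N : ℝ) * (2 * (G.edgeFinset.card : ℝ) + (Fintype.card V : ℝ)) * r_max := by
  have hP (i : ℕ) : rowNormAdj V G ^ i ∈ rowStochastic ℝ V :=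
    pow_mem (rowNormAdj_mem_rowStochastic G) i
  set C : ℝ := 2 * (G.edgeFinset.card : ℝ) + (Fintype.card V : ℝ) with hC
  have hC0 : 0 ≤ C * r_max := by positivity
  have hmass (m : ℕ) (hm : m < N) : ∑ v, r m v ≤ C * r_max := by
    rw [hC, ← sum_degree_add_one, Finset.sum_mul]
    exact Finset.sum_le_sum fun v _ => hterm v m hm
  have hnonneg (n : ℕ) (hn : n ≤ N) (u : V) : 0 ≤ (rowNormAdj V G ^ n) s u - q n u := by
    rw [hinv n hn u, add_sub_cancel_left]
    refine Finset.sum_nonneg fun i _ => ?_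
    rw [mulVec_transpose]
    exact nonneg_vecMul_of_mem_rowStochastic (hP i) (hr (n - i) (by omega)) u
  have hstep (n : ℕ) (hn : n ≤ N) :
      ∑ u, ((rowNormAdj V G ^ n) s u - q n u) ≤ N * (C * r_max) := by
    calc ∑ u, ((rowNormAdj V G ^ n) s u - q n u)
        = ∑ i ∈ Finset.Icc 1 n, ∑ v, r (n - i) v := by
          simp_rw [fun u => sub_eq_of_eq_add' (hinv n hn u)]
          rw [Finset.sum_comm]
          exact Finset.sum_congr rfl fun i _ =>
            sum_transpose_mulVec_of_mem_rowStochastic (hP i) _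
      _ ≤ ∑ i ∈ Finset.Icc 1 n, C * r_max := by
          refine Finset.sum_le_sum fun i hi => hmass _ ?_
          rw [Finset.mem_Icc] at hi
          omega
      _ = n * (C * r_max) := by simp
      _ ≤ N * (C * r_max) := by gcongr
  calc ∑ u, |(∑ n ∈ Finset.range (N + 1), w n * (rowNormAdj V G ^ n) s u)
          - ∑ n ∈ Finset.range (N + 1), w n * q n u|
      = ∑ u, ∑ n ∈ Finset.range (N + 1), w n * ((rowNormAdj V G ^ n) s u - q n u) := by
        refine Finset.sum_congr rfl fun u _ => ?_
        simp_rw [← Finset.sum_sub_distrib, ← mul_sub]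
        refine abs_of_nonneg (Finset.sum_nonneg fun n hn => ?_)
        have hnN : n ≤ N := Finset.mem_range_succ_iff.mp hn
        exact mul_nonneg (hw n hnN) (hnonneg n hnN u)
    _ = ∑ n ∈ Finset.range (N + 1), w n * ∑ u, ((rowNormAdj V G ^ n) s u - q n u) := by
        rw [Finset.sum_comm]
        simp_rw [Finset.mul_sum]
    _ ≤ ∑ n ∈ Finset.range (N + 1), w n * (N * (C * r_max)) := by
        refine Finset.sum_le_sum fun n hn => ?_
        have hnN : n ≤ N := Finset.mem_range_succ_iff.mp hn
        exact mul_le_mul_of_nonneg_left (hstep n hnN) (hw n hnN)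
    _ = N * C * r_max := by rw [← Finset.sum_mul, hwsum, one_mul, mul_assoc]
end

section
/- Let r ∈ ℝ^V be entrywise nonnegative with ‖r‖₁ ≤ 1, let r_max > 0, and let S = {v ∈ V : r_v > d_v · r_max}. If q ∈ ℝ^V is any vector whose support is contained in ⋃_{v∈S} N_v, then q has at most 1/r_max nonzero entries. (Core of the memory-complexity bound in Theorem 1: each reserve vector produced in one step of GFPush has at most 1/r_max nonzero elements.) -/
open Finset Matrix

open scoped Classical in
/-- Core of the memory-complexity bound in Theorem 1 of "GRAND+": let `r ∈ ℝ^V` be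
entrywise nonnegative with `‖r‖₁ ≤ 1`, let `r_max > 0`, and let
`S = {v : r_v > d_v · r_max}` (with `d_v = deg_G v + 1` the degree in the self-loop-augmented
graph).  If the support of `q ∈ ℝ^V` is contained in `⋃_{v ∈ S} N_v`, where `N_v` is the
closed neighborhood of `v`, then `q` has at most `1 / r_max` nonzero entries. -/
theorem gfpush_reserve_sparsity
    {V : Type} [Fintype V] [DecidableEq V]
    (G : SimpleGraph V) [DecidableRel G.Adj]
    (r : V → ℝ) (hr : ∀ v, 0 ≤ r v) (hr1 : ∑ v, |r v| ≤ 1)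
    (r_max : ℝ) (hrmax : 0 < r_max)
    (q : V → ℝ)
    (hsupp : ∀ u, q u ≠ 0 →
      ∃ v, ((G.degree v : ℝ) + 1) * r_max < r v ∧ (u = v ∨ G.Adj v u)) :
    ((Finset.univ.filter fun u => q u ≠ 0).card : ℝ) ≤ 1 / r_max := by
  set S := Finset.univ.filter fun v => ((G.degree v : ℝ) + 1) * r_max < r v with hS
  have hsub : (Finset.univ.filter fun u => q u ≠ 0) ⊆
      S.biUnion fun v => insert v (G.neighborFinset v) := by
    intro u hu
    obtain ⟨v, hv, huv⟩ := hsupp u (Finset.mem_filter.mp hu).2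
    refine Finset.mem_biUnion.mpr ⟨v, by simpa [hS] using hv, ?_⟩
    simpa only [Finset.mem_insert, SimpleGraph.mem_neighborFinset] using huv
  have hcard : (Finset.univ.filter fun u => q u ≠ 0).card ≤ ∑ v ∈ S, (G.degree v + 1) :=
    (Finset.card_le_card hsub).trans <| Finset.card_biUnion_le.trans <|
      Finset.sum_le_sum fun v _ => by
        simp
  rw [le_div_iff₀ hrmax]
  calc ((Finset.univ.filter fun u => q u ≠ 0).card : ℝ) * r_max
      ≤ (∑ v ∈ S, ((G.degree v : ℝ) + 1)) * r_max := by
        gcongr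
        exact_mod_cast hcard
    _ = ∑ v ∈ S, ((G.degree v : ℝ) + 1) * r_max := Finset.sum_mul _ _ _
    _ ≤ ∑ v ∈ S, |r v| :=
        Finset.sum_le_sum fun v hv => (Finset.mem_filter.mp hv).2.le.trans (le_abs_self _)
    _ ≤ ∑ v, |r v| :=
        Finset.sum_le_univ_sum_of_nonneg fun v => abs_nonneg _
    _ ≤ 1 := hr1
end

section
/- Every state (q^(0), …, q^(N), r^(0), …, r^(N)) obtained from the GFPush initial state by applying a finite sequence of push operations satisfies the GFPush invariant for s: for every 0 ≤ n ≤ N, P^n_s = q^(n) + Σ_{i=1}^{n} (P^i)ᵀ r^(n−i). (Lemma 1.) -/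
open Finset Matrix

/-- The GFPush initial state: `q⁽⁰⁾ = r⁽⁰⁾ = e⁽ˢ⁾` and `q⁽ⁿ⁾ = r⁽ⁿ⁾ = 0` for `1 ≤ n`. -/
noncomputable def gfInit {V : Type} [DecidableEq V] (s : V) : ℕ → V → ℝ :=
  fun n u => if n = 0 ∧ u = s then 1 else 0

/-- Effect of a push operation on node `v` at level `n'` on the family of reserve vectors:
`q⁽ⁿ'⁾` is incremented by `(r⁽ⁿ'⁻¹⁾_v / d_v) · Σ_{u ∈ N_v} e⁽ᵘ⁾`, other levels unchanged. -/
noncomputable def pushQ {V : Type} [Fintype V] [DecidableEq V]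
    (G : SimpleGraph V) [DecidableRel G.Adj]
    (q r : ℕ → V → ℝ) (v : V) (n' : ℕ) : ℕ → V → ℝ :=
  fun n u =>
    if n = n' then
      q n u + r (n' - 1) v / ((G.degree v : ℝ) + 1) * (if u = v ∨ G.Adj v u then 1 else 0)
    else q n u

/-- Effect of a push operation on node `v` at level `n'` on the family of residue vectors:
`r⁽ⁿ'⁻¹⁾` loses its mass at `v`, and `r⁽ⁿ'⁾` is incremented by
`(r⁽ⁿ'⁻¹⁾_v / d_v) · Σ_{u ∈ N_v} e⁽ᵘ⁾`; other levels are unchanged. -/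
noncomputable def pushR {V : Type} [Fintype V] [DecidableEq V]
    (G : SimpleGraph V) [DecidableRel G.Adj]
    (r : ℕ → V → ℝ) (v : V) (n' : ℕ) : ℕ → V → ℝ :=
  fun n u =>
    if n = n' - 1 then r n u - r (n' - 1) v * (if u = v then 1 else 0)
    else if n = n' then
      r n u + r (n' - 1) v / ((G.degree v : ℝ) + 1) * (if u = v ∨ G.Adj v u then 1 else 0)
    else r n u

/-- States `(q⁽⁰⁾,…,q⁽ᴺ⁾, r⁽⁰⁾,…,r⁽ᴺ⁾)` reachable from the GFPush initial state for source `s`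
by a finite sequence of push operations at levels `1 ≤ n' ≤ N`. -/
inductive GFReach {V : Type} [Fintype V] [DecidableEq V]
    (G : SimpleGraph V) [DecidableRel G.Adj] (s : V) (N : ℕ) :
    (ℕ → V → ℝ) → (ℕ → V → ℝ) → Prop
  | init : GFReach G s N (gfInit s) (gfInit s)
  | push (q r : ℕ → V → ℝ) (v : V) (n' : ℕ) (h1 : 1 ≤ n') (h2 : n' ≤ N)
      (h : GFReach G s N q r) :
      GFReach G s N (pushQ G q r v n') (pushR G r v n')

theorem pushQ_eq {V : Type} [Fintype V] [DecidableEq V]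
    (G : SimpleGraph V) [DecidableRel G.Adj] (q r : ℕ → V → ℝ) (v : V) (m n : ℕ) (u : V) :
    pushQ G q r v (m + 1) n u
      = q n u + if n = m + 1 then r m v * rowNormAdj V G v u else 0 := by
  unfold pushQ rowNormAdj
  by_cases h : n = m + 1 <;> by_cases h' : u = v ∨ G.Adj v u <;>
    simp [h, h', div_eq_mul_inv]

theorem pushR_eq {V : Type} [Fintype V] [DecidableEq V]
    (G : SimpleGraph V) [DecidableRel G.Adj] (r : ℕ → V → ℝ) (v : V) (m n : ℕ) :
    pushR G r v (m + 1) n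
      = r n + (if n = m + 1 then r m v else 0) • rowNormAdj V G v
        - (if n = m then r m v else 0) • Pi.single v 1 := by
  ext u
  unfold pushR rowNormAdj
  have hne : m ≠ m + 1 := by omega
  by_cases h : n = m
  · simp [h, Pi.single_apply]
  · by_cases h₂ : n = m + 1 <;> by_cases h' : u = v ∨ G.Adj v u <;>
      simp [h, h₂, h', div_eq_mul_inv]

/-- A push at level `m + 1` changes each propagated residue by a difference of matrix powers. -/
theorem transpose_pow_mulVec_pushR {V : Type} [Fintype V] [DecidableEq V]
    (G : SimpleGraph V) [DecidableRel G.Adj] (r : ℕ → V → ℝ) (v : V) (m n i : ℕ) (u : V) :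
    ((rowNormAdj V G ^ i)ᵀ.mulVec (pushR G r v (m + 1) n)) u
      = ((rowNormAdj V G ^ i)ᵀ.mulVec (r n)) u
        + (if n = m + 1 then r m v * (rowNormAdj V G ^ (i + 1)) v u else 0)
        - (if n = m then r m v * (rowNormAdj V G ^ i) v u else 0) := by
  have hrow : ((rowNormAdj V G ^ i)ᵀ.mulVec (rowNormAdj V G v)) u
      = (rowNormAdj V G ^ (i + 1)) v u := by
    rw [mulVec_transpose, pow_succ', Matrix.mul_apply]
    rfl
  rw [pushR_eq, mulVec_sub, mulVec_add, mulVec_smul, mulVec_smul]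
  simp only [Pi.sub_apply, Pi.add_apply, Pi.smul_apply, smul_eq_mul, hrow, mulVec_single_one,
    col_apply, transpose_apply, ite_mul, zero_mul]

/-- The right-hand side of the GFPush invariant is unchanged by a push operation. -/
theorem push_preserves_invariant_sum {V : Type} [Fintype V] [DecidableEq V]
    (G : SimpleGraph V) [DecidableRel G.Adj] (q r : ℕ → V → ℝ) (v : V) (m n : ℕ) (u : V) :
    pushQ G q r v (m + 1) n u
        + ∑ i ∈ Finset.Icc 1 n, ((rowNormAdj V G ^ i)ᵀ.mulVec (pushR G r v (m + 1) (n - i))) u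
      = q n u + ∑ i ∈ Finset.Icc 1 n, ((rowNormAdj V G ^ i)ᵀ.mulVec (r (n - i))) u := by
  simp only [transpose_pow_mulVec_pushR, pushQ_eq, Finset.sum_sub_distrib,
    Finset.sum_add_distrib]
  have key (k : ℕ) (f : ℕ → ℝ) :
      ∑ i ∈ Finset.Icc 1 n, (if n - i = k then f i else 0) = if k < n then f (n - k) else 0 := by
    split_ifs with hk
    · rw [Finset.sum_eq_single_of_mem (n - k) (Finset.mem_Icc.2 (by omega)),
        if_pos (by omega)]
      intro i hi hne
      rw [Finset.mem_Icc] at hi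
      exact if_neg (by omega)
    · refine Finset.sum_eq_zero fun i hi => if_neg ?_
      rw [Finset.mem_Icc] at hi
      omega
  rw [key (m + 1) fun i => r m v * (rowNormAdj V G ^ (i + 1)) v u,
    key m fun i => r m v * (rowNormAdj V G ^ i) v u]
  rcases lt_trichotomy n (m + 1) with h | rfl | h
  · simp [show n ≠ m + 1 by omega, show ¬ m + 1 < n by omega, show ¬ m < n by omega]
  · simp
  · simp [show n ≠ m + 1 by omega, h, show m < n by omega,
      show n - (m + 1) + 1 = n - m by omega]

theorem gfInit_invariant {V : Type} [Fintype V] [DecidableEq V]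
    (G : SimpleGraph V) [DecidableRel G.Adj] (s : V) (n : ℕ) (u : V) :
    (rowNormAdj V G ^ n) s u
      = gfInit s n u
        + ∑ i ∈ Finset.Icc 1 n, ((rowNormAdj V G ^ i)ᵀ.mulVec (gfInit s (n - i))) u := by
  rcases n with _ | n
  · simp [gfInit, Matrix.one_apply, eq_comm]
  · have h_zero : gfInit s 0 = Pi.single s 1 := by
      ext u
      simp [gfInit, Pi.single_apply]
    rw [Finset.sum_eq_single_of_mem (n + 1) (by simp)]
    · simp [h_zero, gfInit, -transpose_pow]
    · intro i hi hne
      rw [Finset.mem_Icc] at hi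
      have h_init : gfInit s (n + 1 - i) = 0 := by
        ext u
        simp [gfInit, show n + 1 - i ≠ 0 by omega]
      simp [h_init]

/-- Lemma 1 of "GRAND+: Scalable Graph Random Neural Networks": every state obtained from the
GFPush initial state by a finite sequence of push operations satisfies the GFPush invariant:
for every `0 ≤ n ≤ N`, `P^n_s = q⁽ⁿ⁾ + Σ_{i=1}^{n} (P^i)ᵀ r⁽ⁿ⁻ⁱ⁾`. -/
theorem gfpush_reachable_invariant
    {V : Type} [Fintype V] [DecidableEq V]
    (G : SimpleGraph V) [DecidableRel G.Adj]
    (s : V) (N : ℕ) (hN : 1 ≤ N)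
    (q r : ℕ → V → ℝ)
    (hreach : GFReach G s N q r) :
    ∀ n ≤ N, ∀ u, (rowNormAdj V G ^ n) s u
      = q n u + ∑ i ∈ Finset.Icc 1 n, ((rowNormAdj V G ^ i)ᵀ.mulVec (r (n - i))) u := by
  induction hreach with
  | init => exact fun n _ u => gfInit_invariant G s n u
  | push q r v n' h1 h2 h ih =>
    intro n hn u
    obtain ⟨m, rfl⟩ := Nat.exists_eq_add_of_le' h1
    rw [push_preserves_invariant_sum]
    exact ih n hn u
end
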